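/- Let S and A be finite nonempty types, P : S → A → PMF(S) a transition kernel, r : S → A → ℝ a reward function with r_min ≤ r(s,a) ≤ r_max for all s, a, and γ ∈ [0, 1). Suppose V : S → ℝ satisfies the Bellman optimality equation V(s) = max_{a ∈ A} [ r(s,a) + γ · Σ_{s' ∈ S} P(s'|s,a) · V(s') ] for every s ∈ S. Then the span of V satisfies max_{s ∈ S} V(s) − min_{s ∈ S} V(s) ≤ (r_max − r_min) / (1 − γ). -/

import Mathlib

theorem PMF.sum_toReal_eq_one {S : Type*} [Fintype S] (p : PMF S) :
    ∑ s : S, (p s).toReal = 1 := by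
  rw [← ENNReal.toReal_sum fun s _ => p.apply_ne_top s,
    ← tsum_fintype (L := .unconditional S), p.tsum_coe,
    ENNReal.toReal_one]

theorem PMF.sum_toReal_mul_le {S : Type*} [Fintype S] (p : PMF S) {f : S → ℝ} {c : ℝ}
    (h : ∀ s, f s ≤ c) : ∑ s : S, (p s).toReal * f s ≤ c :=
  calc ∑ s : S, (p s).toReal * f s ≤ ∑ s : S, (p s).toReal * c :=
        Finset.sum_le_sum fun s _ => mul_le_mul_of_nonneg_left (h s) ENNReal.toReal_nonneg
    _ = c := by rw [← Finset.sum_mul, p.sum_toReal_eq_one, one_mul]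

theorem PMF.le_sum_toReal_mul {S : Type*} [Fintype S] (p : PMF S) {f : S → ℝ} {c : ℝ}
    (h : ∀ s, c ≤ f s) : c ≤ ∑ s : S, (p s).toReal * f s :=
  calc c = ∑ s : S, (p s).toReal * c := by rw [← Finset.sum_mul, p.sum_toReal_eq_one, one_mul]
    _ ≤ ∑ s : S, (p s).toReal * f s :=
        Finset.sum_le_sum fun s _ => mul_le_mul_of_nonneg_left (h s) ENNReal.toReal_nonneg

/-- **Span bound for the optimal value function of a finite MDP.**
If `V` satisfies the Bellman optimality equation
`V(s) = max_a [ r(s,a) + γ ∑_{s'} P(s'|s,a) V(s') ]` with `r_min ≤ r ≤ r_max`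
and `γ ∈ [0,1)`, then `max_s V(s) − min_s V(s) ≤ (r_max − r_min)/(1 − γ)`. -/
theorem bellman_span_le
    {S A : Type*} [Fintype S] [Nonempty S] [Fintype A] [Nonempty A]
    (P : S → A → PMF S) (r : S → A → ℝ) (rmin rmax : ℝ)
    (hr : ∀ s a, rmin ≤ r s a ∧ r s a ≤ rmax)
    (γ : ℝ) (hγ0 : 0 ≤ γ) (hγ1 : γ < 1)
    (V : S → ℝ)
    (hV : ∀ s, V s = ⨆ a : A, (r s a + γ * ∑ s' : S, ((P s a) s').toReal * V s')) :
    (⨆ s : S, V s) - (⨅ s : S, V s) ≤ (rmax - rmin) / (1 - γ) := by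
  have hle : ∀ s, V s ≤ ⨆ s, V s := le_ciSup (Set.finite_range V).bddAbove
  have hge : ∀ s, ⨅ s, V s ≤ V s := ciInf_le (Set.finite_range V).bddBelow
  have hsup : ⨆ s, V s ≤ rmax + γ * ⨆ s, V s := by
    refine ciSup_le fun s => (hV s).trans_le (ciSup_le fun a => ?_)
    exact add_le_add (hr s a).2
      (mul_le_mul_of_nonneg_left ((P s a).sum_toReal_mul_le hle) hγ0)
  have hinf : rmin + γ * ⨅ s, V s ≤ ⨅ s, V s := by
    refine le_ciInf fun s => ?_
    obtain ⟨a⟩ := ‹Nonempty A›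
    rw [hV s]
    exact (add_le_add (hr s a).1
      (mul_le_mul_of_nonneg_left ((P s a).le_sum_toReal_mul hge) hγ0)).trans
      (le_ciSup (f := fun a => r s a + γ * ∑ s', ((P s a) s').toReal * V s')
        (Set.finite_range _).bddAbove a)
  rw [le_div_iff₀ (sub_pos.2 hγ1)]
  linarith
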